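/- Let G be an SSG and σ a MAX strategy with nonempty switch set S_σ. For every σ-switch σ', one has v_{σ'} > v_σ (pointwise ≥ with at least one strict inequality). -/

import Mathlib

open scoped BigOperators

instance : Fact ((0:ℝ) ≤ 1) := ⟨zero_le_one⟩

/-- A simple stochastic game on a finite vertex set `V`. -/
structure SSG (V : Type*) [Fintype V] [DecidableEq V] where
  /-- MAX vertices -/
  VMax : Finset V
  /-- MIN vertices -/
  VMin : Finset V
  /-- random vertices -/
  VR : Finset V
  /-- sink vertices -/
  VS : Finset V
  cover : ∀ x : V, x ∈ VMax ∨ x ∈ VMin ∨ x ∈ VR ∨ x ∈ VS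
  disjMaxMin : Disjoint VMax VMin
  disjMaxR : Disjoint VMax VR
  disjMaxS : Disjoint VMax VS
  disjMinR : Disjoint VMin VR
  disjMinS : Disjoint VMin VS
  disjRS : Disjoint VR VS
  /-- out-neighbourhood: `y ∈ succ x` iff `(x,y)` is an edge -/
  succ : V → Finset V
  outMax : ∀ x ∈ VMax, 2 ≤ (succ x).card
  outMin : ∀ x ∈ VMin, 2 ≤ (succ x).card
  outR : ∀ x ∈ VR, 1 ≤ (succ x).card
  /-- transition probabilities at random vertices -/
  prob : V → V → ℝ
  prob_nonneg : ∀ x y, 0 ≤ prob x y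
  prob_support : ∀ x ∈ VR, ∀ y, y ∉ succ x → prob x y = 0
  prob_sum : ∀ x ∈ VR, (∑ y, prob x y) = 1
  /-- values of the sinks -/
  val : V → ℝ
  val_mem : ∀ x ∈ VS, val x ∈ Set.Icc (0:ℝ) 1

namespace SSG

variable {V : Type*} [Fintype V] [DecidableEq V]

/-- A positional MAX strategy: a choice of an out-neighbour at every MAX vertex
(normalised to the identity away from `VMax`). -/
structure MaxStrategy (G : SSG V) where
  toFun : V → V
  mem_succ : ∀ x ∈ G.VMax, toFun x ∈ G.succ x
  eq_id : ∀ x ∉ G.VMax, toFun x = x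

/-- A positional MIN strategy. -/
structure MinStrategy (G : SSG V) where
  toFun : V → V
  mem_succ : ∀ x ∈ G.VMin, toFun x ∈ G.succ x
  eq_id : ∀ x ∉ G.VMin, toFun x = x

/-- The one-step (monotone) operator on value vectors associated with `(σ,τ)`. -/
noncomputable def F (G : SSG V) (σ : G.MaxStrategy) (τ : G.MinStrategy)
    (w : V → unitInterval) (x : V) : unitInterval :=
  if _hM : x ∈ G.VMax then w (σ.toFun x)
  else if _hN : x ∈ G.VMin then w (τ.toFun x)
  else if hR : x ∈ G.VR then
    ⟨∑ y, G.prob x y * (w y : ℝ), by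
      constructor
      · exact Finset.sum_nonneg fun y _ =>
          mul_nonneg (G.prob_nonneg x y) (w y).2.1
      · calc (∑ y, G.prob x y * (w y : ℝ)) ≤ ∑ y, G.prob x y :=
              Finset.sum_le_sum fun y _ =>
                mul_le_of_le_one_right (G.prob_nonneg x y) (w y).2.2
          _ = 1 := G.prob_sum x hR⟩
  else ⟨G.val x, G.val_mem x (by
    rcases G.cover x with h | h | h | h
    · exact absurd h _hM
    · exact absurd h _hN
    · exact absurd h hR
    · exact h)⟩

/-- The value vector `v_{σ,τ}`: the least fixed point (à la Knaster–Tarski) of `F`. -/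
noncomputable def value (G : SSG V) (σ : G.MaxStrategy) (τ : G.MinStrategy) :
    V → unitInterval :=
  sInf {w : V → unitInterval | G.F σ τ w ≤ w}

/-- `τ` is a best response to `σ`. -/
def IsBestResponse (G : SSG V) (σ : G.MaxStrategy) (τ : G.MinStrategy) : Prop :=
  ∀ τ' : G.MinStrategy, G.value σ τ ≤ G.value σ τ'

/-- `σ` is an optimal MAX strategy: `v_σ ≥ v_{σ'}` for every MAX strategy `σ'`
(values being computed against best responses). -/
def IsOptimal (G : SSG V) (σ : G.MaxStrategy) : Prop :=
  ∀ τ : G.MinStrategy, G.IsBestResponse σ τ →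
    ∀ σ' : G.MaxStrategy, ∀ τ' : G.MinStrategy, G.IsBestResponse σ' τ' →
      G.value σ' τ' ≤ G.value σ τ

/-- The switch set `S_σ` of `σ`, computed with a best response `τ` to `σ`. -/
def switchSet (G : SSG V) (σ : G.MaxStrategy) (τ : G.MinStrategy) : Set V :=
  {x | x ∈ G.VMax ∧ ∃ y ∈ G.succ x, G.value σ τ x < G.value σ τ y}

/-- `σ'` is a `σ`-switch (w.r.t. a best response `τ` to `σ`). -/
def IsSwitch (G : SSG V) (σ : G.MaxStrategy) (τ : G.MinStrategy)
    (σ' : G.MaxStrategy) : Prop :=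
  σ' ≠ σ ∧
  (∀ x ∈ G.VMax, x ∉ G.switchSet σ τ → σ'.toFun x = σ.toFun x) ∧
  (∀ x ∈ G.switchSet σ τ, σ'.toFun x ≠ σ.toFun x →
    G.value σ τ x < G.value σ τ (σ'.toFun x))

/-- `σ` agrees with `σ₀` on `T`. -/
def AgreesOn (G : SSG V) (T : Set V) (σ₀ σ : G.MaxStrategy) : Prop :=
  ∀ x ∈ T, σ.toFun x = σ₀.toFun x

/-- `σ` is an optimal MAX strategy of the subgame `G_{|T[σ₀]}`: it agrees with `σ₀` on `T`
and its value vector dominates that of every MAX strategy of `G` agreeing with `σ₀` on `T`. -/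
def IsOptimalOn (G : SSG V) (T : Set V) (σ₀ σ : G.MaxStrategy) : Prop :=
  G.AgreesOn T σ₀ σ ∧
  ∀ σ' : G.MaxStrategy, G.AgreesOn T σ₀ σ' →
    ∀ τ τ' : G.MinStrategy, G.IsBestResponse σ τ → G.IsBestResponse σ' τ' →
      G.value σ' τ' ≤ G.value σ τ

/-- `σ'` is a `(σ,T)`-super-switch (w.r.t. a best response `τ` to `σ`): it is obtained from an
intermediate `σ`-switch `σ''` that only switches inside `T`, by taking an optimal strategy of
the subgame `G_{|T[σ'']}`. -/
def IsSuperSwitch (G : SSG V) (σ : G.MaxStrategy) (τ : G.MinStrategy)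
    (T : Set V) (σ' : G.MaxStrategy) : Prop :=
  ∃ σ'' : G.MaxStrategy, G.IsSwitch σ τ σ'' ∧
    (∀ x ∈ G.VMax, x ∉ T → σ''.toFun x = σ.toFun x) ∧
    G.IsOptimalOn T σ'' σ'

/-- A binary SSG: every MAX vertex has outdegree exactly 2. -/
def Binary (G : SSG V) : Prop := ∀ x ∈ G.VMax, (G.succ x).card = 2

/-- `σb` is the total switch `σ̄` of `σ` (in a binary SSG): it switches to the other
out-neighbour exactly on the switch set of `σ`. -/
def IsTotalSwitch (G : SSG V) (σ : G.MaxStrategy) (τ : G.MinStrategy)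
    (σb : G.MaxStrategy) : Prop :=
  (∀ x ∈ G.switchSet σ τ, σb.toFun x ≠ σ.toFun x) ∧
  (∀ x ∈ G.VMax, x ∉ G.switchSet σ τ → σb.toFun x = σ.toFun x)

end SSG

namespace SSG

variable {V : Type*} [Fintype V] [DecidableEq V]

theorem F_mono (G : SSG V) (σ : G.MaxStrategy) (τ : G.MinStrategy) : Monotone (G.F σ τ) := by
  intro a b h x
  unfold F
  split_ifs with h1 h2 h3
  · exact h _
  · exact h _
  · rw [← Subtype.coe_le_coe]
    exact Finset.sum_le_sum fun y _ => mul_le_mul_of_nonneg_left (h y) (G.prob_nonneg x y)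
  · exact le_rfl

theorem value_fix (G : SSG V) (σ : G.MaxStrategy) (τ : G.MinStrategy) :
    G.F σ τ (G.value σ τ) = G.value σ τ :=
  OrderHom.map_lfp (⟨G.F σ τ, G.F_mono σ τ⟩ : (V → unitInterval) →o (V → unitInterval))

theorem value_le (G : SSG V) (σ : G.MaxStrategy) (τ : G.MinStrategy) {w : V → unitInterval}
    (h : G.F σ τ w ≤ w) : G.value σ τ ≤ w := sInf_le h

theorem F_max (G : SSG V) (σ : G.MaxStrategy) (τ : G.MinStrategy) (w : V → unitInterval)
    {x : V} (h : x ∈ G.VMax) : G.F σ τ w x = w (σ.toFun x) := by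
  simp [F, h]

theorem F_min (G : SSG V) (σ : G.MaxStrategy) (τ : G.MinStrategy) (w : V → unitInterval)
    {x : V} (h : x ∈ G.VMin) : G.F σ τ w x = w (τ.toFun x) := by
  have h1 : x ∉ G.VMax := Finset.disjoint_right.1 G.disjMaxMin h
  simp [F, h, h1]

theorem F_rand (G : SSG V) (σ : G.MaxStrategy) (τ : G.MinStrategy) (w : V → unitInterval)
    {x : V} (h : x ∈ G.VR) : (G.F σ τ w x : ℝ) = ∑ y, G.prob x y * (w y : ℝ) := by
  have h1 : x ∉ G.VMax := Finset.disjoint_right.1 G.disjMaxR h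
  have h2 : x ∉ G.VMin := Finset.disjoint_right.1 G.disjMinR h
  simp [F, h, h1, h2]

theorem F_sink (G : SSG V) (σ : G.MaxStrategy) (τ : G.MinStrategy) (w : V → unitInterval)
    {x : V} (h : x ∈ G.VS) : (G.F σ τ w x : ℝ) = G.val x := by
  have h1 : x ∉ G.VMax := Finset.disjoint_right.1 G.disjMaxS h
  have h2 : x ∉ G.VMin := Finset.disjoint_right.1 G.disjMinS h
  have h3 : x ∉ G.VR := Finset.disjoint_right.1 G.disjRS h
  simp [F, h1, h2, h3]

theorem br_min (G : SSG V) (σ : G.MaxStrategy) (τ : G.MinStrategy)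
    (hbr : G.IsBestResponse σ τ) {x y : V} (hx : x ∈ G.VMin) (hy : y ∈ G.succ x) :
    G.value σ τ x ≤ G.value σ τ y := by
  by_contra hlt
  push Not at hlt
  let τ₂ : G.MinStrategy :=
    { toFun := Function.update τ.toFun x y
      mem_succ := by
        intro z hz
        by_cases hzx : z = x
        · subst hzx; simpa using hy
        · simpa [hzx] using τ.mem_succ z hz
      eq_id := by
        intro z hz
        have hzx : z ≠ x := by rintro rfl; exact hz hx
        simpa [hzx] using τ.eq_id z hz }
  have hle : G.F σ τ₂ (G.value σ τ) ≤ G.value σ τ := by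
    intro z
    by_cases hzx : z = x
    · subst hzx
      rw [F_min _ _ _ _ hx]
      simpa [τ₂] using hlt.le
    · refine le_trans (le_of_eq ?_) (le_of_eq (congrFun (G.value_fix σ τ) z))
      simp [F, τ₂, hzx]
  have heq : G.value σ τ₂ = G.value σ τ := le_antisymm (G.value_le σ τ₂ hle) (hbr τ₂)
  have h1 := congrFun (G.value_fix σ τ₂) x
  rw [F_min _ _ _ _ hx, heq] at h1
  simp only [τ₂, Function.update_self] at h1
  exact absurd h1 hlt.ne

end SSG

theorem switch_improves {V : Type*} [Fintype V] [DecidableEq V] (G : SSG V)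
    (σ σ' : G.MaxStrategy) (τ τ' : G.MinStrategy)
    (hbr : G.IsBestResponse σ τ) (hbr' : G.IsBestResponse σ' τ')
    (hne : (G.switchSet σ τ).Nonempty) (hsw : G.IsSwitch σ τ σ') :
    G.value σ τ < G.value σ' τ' := by
  obtain ⟨hneq, hns, hs⟩ := hsw
  have hsucc : ∀ x ∈ G.VMax, σ'.toFun x ≠ σ.toFun x →
      G.value σ τ x < G.value σ τ (σ'.toFun x) := by
    intro x hx hd
    by_cases hxs : x ∈ G.switchSet σ τ
    · exact hs x hxs hd
    · exact absurd (hns x hx hxs) hd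
  have fixv := G.value_fix σ τ
  have fixw := G.value_fix σ' τ'
  have hmin : ∀ x ∈ G.VMin, G.value σ τ x ≤ G.value σ τ (τ'.toFun x) :=
    fun x hx => G.br_min σ τ hbr hx (τ'.mem_succ x hx)
  have hother : ∀ u : V → unitInterval, G.F σ τ' u ≤ u → G.value σ τ ≤ u :=
    fun u hu => (hbr τ').trans (G.value_le σ τ' hu)
  generalize G.value σ τ = v at *
  generalize G.value σ' τ' = w at *
  have hle : v ≤ w := by
    by_contra hnle
    rw [Pi.le_def] at hnle
    push Not at hnle
    obtain ⟨x₀, hx₀⟩ := hnle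
    obtain ⟨m, -, hm⟩ := Finset.exists_max_image Finset.univ (fun x => (v x : ℝ) - w x)
      ⟨x₀, Finset.mem_univ _⟩
    have hm' : ∀ x, (v x : ℝ) - w x ≤ v m - w m := fun x => hm x (Finset.mem_univ _)
    have hpos : (0:ℝ) < v m - w m := by
      have h1 := hm' x₀
      have h2 : (w x₀ : ℝ) < v x₀ := hx₀
      linarith
    obtain ⟨d, hd⟩ : ∃ d : ℝ, (v m : ℝ) - w m = d := ⟨_, rfl⟩
    rw [hd] at hpos
    simp only [hd] at hm'
    classical
    have key : G.F σ τ' (fun x => if (v x : ℝ) - w x = d then 0 else 1) ≤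
        (fun x => if (v x : ℝ) - w x = d then 0 else 1) := by
      intro x
      by_cases hx : (v x : ℝ) - w x = d
      swap
      · simp only [hx, if_false]
        exact unitInterval.le_one'
      have hvx := congrArg (Subtype.val) (congrFun fixv x)
      have hwx := congrArg (Subtype.val) (congrFun fixw x)
      simp only [hx, if_true]
      rcases G.cover x with hc | hc | hc | hc
      · rw [SSG.F_max _ _ _ _ hc] at hvx hwx ⊢
        have hsame : σ'.toFun x = σ.toFun x := by
          by_contra hne'
          have h1 : (v x : ℝ) < v (σ'.toFun x) := hsucc x hc hne'
          have h2 := hm' (σ'.toFun x)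
          linarith
        rw [hsame] at hwx
        rw [if_pos (by linarith)]
      · rw [SSG.F_min _ _ _ _ hc] at hwx ⊢
        have h1 : (v x : ℝ) ≤ v (τ'.toFun x) := hmin x hc
        have h2 := hm' (τ'.toFun x)
        rw [if_pos (by linarith)]
      · rw [SSG.F_rand _ _ _ _ hc] at hvx hwx
        rw [← Subtype.coe_le_coe, SSG.F_rand _ _ _ _ hc]
        have hsum : ∑ y, G.prob x y * (d - ((v y : ℝ) - w y)) = 0 := by
          simp only [mul_sub, Finset.sum_sub_distrib, ← Finset.sum_mul, G.prob_sum x hc]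
          linarith
        have hz := (Finset.sum_eq_zero_iff_of_nonneg (fun y _ =>
          mul_nonneg (G.prob_nonneg x y) (sub_nonneg.2 (hm' y)))).1 hsum
        refine le_of_eq (Finset.sum_eq_zero fun y hy => ?_)
        rcases mul_eq_zero.1 (hz y hy) with h | h
        · simp [h]
        · rw [if_pos (by linarith)]
          simp
      · rw [SSG.F_sink _ _ _ _ hc] at hvx hwx
        linarith
    have h0 := hother _ key m
    simp only [hd, if_true] at h0
    have h1 : (v m : ℝ) ≤ 0 := h0
    have h2 := (w m).2.1
    linarith
  refine lt_of_le_of_ne hle ?_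
  rintro rfl
  apply hneq
  have : σ'.toFun = σ.toFun := by
    funext x
    by_cases hx : x ∈ G.VMax
    · by_contra hd
      have h1 := hsucc x hx hd
      have h2 := congrFun fixw x
      rw [SSG.F_max _ _ _ _ hx] at h2
      exact absurd h2 h1.ne'
    · rw [σ'.eq_id x hx, σ.eq_id x hx]
  cases σ; cases σ'; simp_all
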